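/- arXiv:math/0004030 — 3 statements merged into one kernel-verified Lean document; each statement's English description precedes it below -/
import Mathlib

section
/- Let H be a complex Hilbert space, M a von Neumann algebra on H with commutant M′, and u ∈ H a trace vector for M that is cyclic both for M and for M′. Let T be an element of M. Then the vector T u is cyclic for M if and only if T is injective. -/
open scoped InnerProductSpace

/-- The conjugation `A u ↦ A† u` extended to limits. -/
lemma exists_conj_vector
    {H : Type*} [NormedAddCommGroup H] [InnerProductSpace ℂ H] [CompleteSpace H]
    (M : VonNeumannAlgebra H) (u : H)
    (htr : ∀ A B : H →L[ℂ] H, A ∈ M → B ∈ M →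
      ⟪(A * B) u, u⟫_ℂ = ⟪(B * A) u, u⟫_ℂ)
    (hcyc : Dense {x : H | ∃ A ∈ M, A u = x})
    (T : H →L[ℂ] H) (hT : T ∈ M) (v : H) :
    ∃ w : H, ‖w‖ = ‖v‖ ∧ (∀ A ∈ M, ⟪v, A (T u)⟫_ℂ = ⟪(star A) u, T w⟫_ℂ) ∧
      (∀ A ∈ M, ⟪w, A (T u)⟫_ℂ = ⟪(star A) u, T v⟫_ℂ) := by
  have adj : ∀ (A : H →L[ℂ] H) (x y : H), ⟪A x, y⟫_ℂ = ⟪x, (star A) y⟫_ℂ := by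
    intro A x y
    rw [ContinuousLinearMap.star_eq_adjoint, ContinuousLinearMap.adjoint_inner_right]
  have hn : ∀ A ∈ M, ‖(star A) u‖ = ‖A u‖ := by
    intro A hA
    have h := htr A (star A) hA (star_mem hA)
    simp only [mul_apply_eq_comp] at h
    rw [adj A ((star A) u) u, adj (star A) (A u) u, star_star, inner_self_eq_norm_sq_to_K,
      inner_self_eq_norm_sq_to_K] at h
    have h2 : ‖(star A) u‖ ^ 2 = ‖A u‖ ^ 2 := by exact_mod_cast h
    exact (sq_eq_sq₀ (norm_nonneg _) (norm_nonneg _)).1 h2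
  have gen : ∀ (C : ℕ → H →L[ℂ] H) (a b : H), (∀ n, C n ∈ M) →
      Filter.Tendsto (fun n => C n u) Filter.atTop (nhds a) →
      Filter.Tendsto (fun n => (star (C n)) u) Filter.atTop (nhds b) →
      ∀ A ∈ M, ⟪a, A (T u)⟫_ℂ = ⟪(star A) u, T b⟫_ℂ := by
    intro C a b hC ha hb A hA
    have h1 : Filter.Tendsto (fun n => ⟪C n u, A (T u)⟫_ℂ) Filter.atTop
        (nhds ⟪a, A (T u)⟫_ℂ) :=
      ha.inner tendsto_const_nhds
    have h2 : Filter.Tendsto (fun n => ⟪(star A) u, T ((star (C n)) u)⟫_ℂ) Filter.atTop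
        (nhds ⟪(star A) u, T b⟫_ℂ) :=
      tendsto_const_nhds.inner ((T.continuous.tendsto b).comp hb)
    refine tendsto_nhds_unique h1 (h2.congr fun n => ?_)
    have h3 := htr (C n) (star T * star A) (hC n) (mul_mem (star_mem hT) (star_mem hA))
    simp only [mul_apply_eq_comp] at h3
    simp only [adj, star_star] at h3 ⊢
    exact h3
  obtain ⟨x, hx, hxv⟩ := mem_closure_iff_seq_limit.1 (hcyc v)
  choose B hB hBx using hx
  have hc : CauchySeq (fun n => (star (B n)) u) := by
    have h1 := hxv.cauchySeq
    rw [Metric.cauchySeq_iff] at h1 ⊢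
    intro ε hε
    obtain ⟨N, hN⟩ := h1 ε hε
    refine ⟨N, fun m hm n hn' => ?_⟩
    have h2 := hN m hm n hn'
    rw [dist_eq_norm, ← hBx, ← hBx, ← sub_apply, ← hn _ (sub_mem (hB m) (hB n))] at h2
    rw [dist_eq_norm]
    simpa using h2
  obtain ⟨w, hw⟩ := cauchySeq_tendsto_of_complete hc
  have hxv' : Filter.Tendsto (fun n => B n u) Filter.atTop (nhds v) := by
    simpa only [hBx] using hxv
  refine ⟨w, ?_, gen B v w hB hxv' hw,
    gen (fun n => star (B n)) w v (fun n => star_mem (hB n)) hw (by simpa using hxv')⟩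
  refine tendsto_nhds_unique hw.norm ?_
  refine hxv.norm.congr fun n => ?_
  rw [hn _ (hB n), hBx]

theorem cyclic_iff_injective
    {H : Type*} [NormedAddCommGroup H] [InnerProductSpace ℂ H] [CompleteSpace H]
    (M : VonNeumannAlgebra H) (u : H)
    (htr : ∀ A B : H →L[ℂ] H, A ∈ M → B ∈ M →
      ⟪(A * B) u, u⟫_ℂ = ⟪(B * A) u, u⟫_ℂ)
    (hcyc : Dense {x : H | ∃ A ∈ M, A u = x})
    (hcyc' : Dense {x : H | ∃ A ∈ M.commutant, A u = x})
    (T : H →L[ℂ] H) (hT : T ∈ M) :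
    Dense {x : H | ∃ A ∈ M, A (T u) = x} ↔ Function.Injective T := by
  have key : ∀ (S : Set H) (y : H), Dense S → (∀ x ∈ S, ⟪y, x⟫_ℂ = 0) → y = 0 := by
    intro S y hS h
    have h1 : (fun x => ⟪y, x⟫_ℂ) = fun _ => 0 :=
      Continuous.ext_on hS (by fun_prop) (by fun_prop) h
    exact inner_self_eq_zero.1 (congrFun h1 y)
  constructor
  · intro hd
    rw [injective_iff_map_eq_zero]
    intro x hx
    obtain ⟨w, hwn, -, hw⟩ := exists_conj_vector M u htr hcyc T hT x
    have hw0 : w = 0 := by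
      refine key _ _ hd ?_
      rintro _ ⟨A, hA, rfl⟩
      rw [hw A hA, hx, inner_zero_right]
    rw [hw0, norm_zero] at hwn
    exact norm_eq_zero.1 hwn.symm
  · intro hinj
    let K : Submodule ℂ H := (Subalgebra.toSubmodule M.toStarSubalgebra.toSubalgebra).map
      (ContinuousLinearMap.apply ℂ H (T u)).toLinearMap
    have hK : (K : Set H) = {x : H | ∃ A ∈ M, A (T u) = x} := rfl
    rw [← hK, Submodule.dense_iff_topologicalClosure_eq_top,
      Submodule.topologicalClosure_eq_top_iff, Submodule.eq_bot_iff]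
    intro v hv
    obtain ⟨w, hwn, hw, -⟩ := exists_conj_vector M u htr hcyc T hT v
    have hTw : T w = 0 := by
      refine key _ _ hcyc ?_
      rintro _ ⟨A, hA, rfl⟩
      have hsA : star A ∈ M := star_mem hA
      have h := hw (star A) hsA
      rw [star_star, (Submodule.mem_orthogonal' K v).1 hv ((star A) (T u)) ⟨star A, hsA, rfl⟩] at h
      rw [← inner_conj_symm, ← h, map_zero]
    have : w = 0 := hinj (by rw [hTw, map_zero])
    rw [this, norm_zero] at hwn
    exact norm_eq_zero.1 hwn.symm
end

section
/- Let H be a complex Hilbert space, M a von Neumann algebra on H with commutant M′, and u ∈ H a trace vector for M that is cyclic both for M and for M′. Let T be an element of M. Then the vector T u is separating for M (i.e. A ∈ M and A T u = 0 imply A = 0) if and only if T has dense range. -/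
open scoped InnerProductSpace

/-- Theorem 2.1, item 3 (bounded case): if `u` is a trace vector for a von
Neumann algebra `M`, cyclic both for `M` and for its commutant `M′`, and
`T ∈ M`, then the vector `T u` is separating for `M` iff `T` has dense range. -/
theorem separating_iff_denseRange
    {H : Type*} [NormedAddCommGroup H] [InnerProductSpace ℂ H] [CompleteSpace H]
    (M : VonNeumannAlgebra H) (u : H)
    (htr : ∀ A B : H →L[ℂ] H, A ∈ M → B ∈ M →
      ⟪(A * B) u, u⟫_ℂ = ⟪(B * A) u, u⟫_ℂ)
    (hcyc : Dense {x : H | ∃ A ∈ M, A u = x})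
    (hcyc' : Dense {x : H | ∃ A ∈ M.commutant, A u = x})
    (T : H →L[ℂ] H) (hT : T ∈ M) :
    (∀ A : H →L[ℂ] H, A ∈ M → A (T u) = 0 → A = 0) ↔ DenseRange T := by
  constructor
  · intro h
    let K : Submodule ℂ H := (LinearMap.range (T : H →ₗ[ℂ] H))ᗮ
    have hK : ∀ z, z ∈ K ↔ ∀ x, ⟪T x, z⟫_ℂ = 0 := by
      intro z
      simp [K, Submodule.mem_orthogonal]
    have hcl : IsClosed (K : Set H) := Submodule.isClosed_orthogonal _
    have : CompleteSpace K := hcl.completeSpace_coe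
    have hP : K.starProjection ∈ M := by
      rw [VonNeumannAlgebra.IsStarProjection.mem_iff isStarProjection_starProjection]
      intro y hy
      rw [Submodule.range_starProjection, Module.End.mem_invtSubmodule]
      intro z hz
      rw [Submodule.mem_comap]
      refine (hK _).2 fun x => ?_
      have hy2 := VonNeumannAlgebra.mem_commutant_iff.1 (star_mem hy) T hT
      have e := congrArg (fun S : H →L[ℂ] H => S x) hy2
      change T (star y x) = star y (T x) at e
      change ⟪T x, y z⟫_ℂ = 0
      rw [← ContinuousLinearMap.adjoint_inner_left, ← ContinuousLinearMap.star_eq_adjoint, ← e]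
      exact (hK z).1 hz _
    have h0 := h _ hP (by
      rw [Submodule.starProjection_apply_eq_zero_iff]
      exact Submodule.le_orthogonal_orthogonal _ ⟨u, rfl⟩)
    have hbot : K = ⊥ := by
      rw [eq_bot_iff]
      intro z hz
      have := Submodule.starProjection_eq_self_iff.2 hz
      rw [h0] at this
      simpa using this.symm
    have := (Submodule.topologicalClosure_eq_top_iff).2 hbot
    have hd := (Submodule.dense_iff_topologicalClosure_eq_top).2 this
    exact hd
  · intro hd A hA h0
    have hAT : ∀ x, A (T x) = 0 := by
      have : (fun x => A (T x)) = fun _ => 0 := by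
        refine Continuous.ext_on hcyc' (by fun_prop) (by fun_prop) ?_
        rintro _ ⟨B, hB, rfl⟩
        have e := congrArg (fun S : H →L[ℂ] H => S u)
          (VonNeumannAlgebra.mem_commutant_iff.1 hB (A * T) (mul_mem hA hT))
        change A (T (B u)) = B (A (T u)) at e
        simp [e, h0]
      exact congrFun this
    have : (A : H → H) = fun _ => 0 :=
      hd.equalizer (by fun_prop) (by fun_prop) (funext hAT)
    ext x
    exact congrFun this x
end

section
/- Let H be a complex Hilbert space, M a von Neumann algebra on H with commutant M′, and u ∈ H a trace vector for M that is cyclic both for M and for M′. Let T be an element of M. Then the vector T u is both cyclic and separating for M if and only if T is injective and has dense range. -/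
open scoped InnerProductSpace

theorem aux_denseRange_iff {H : Type*} [NormedAddCommGroup H] [InnerProductSpace ℂ H]
    [CompleteSpace H] (S : H →L[ℂ] H) : DenseRange S ↔ Function.Injective (star S : H →L[ℂ] H) := by
  have h1 : DenseRange S ↔ S.rangeᗮ = ⊥ := by
    rw [← Submodule.topologicalClosure_eq_top_iff, ← Submodule.dense_iff_topologicalClosure_eq_top]
    rfl
  rw [h1, ContinuousLinearMap.orthogonal_range]
  exact LinearMap.ker_eq_bot

theorem aux_norm {H : Type*} [NormedAddCommGroup H] [InnerProductSpace ℂ H] [CompleteSpace H]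
    (M : VonNeumannAlgebra H) (u : H)
    (htr : ∀ A B : H →L[ℂ] H, A ∈ M → B ∈ M →
      ⟪(A * B) u, u⟫_ℂ = ⟪(B * A) u, u⟫_ℂ) (A : H →L[ℂ] H) (hA : A ∈ M) :
    ‖(star A) u‖ = ‖A u‖ := by
  have h := htr A (star A) hA (star_mem hA)
  have h1 : ⟪(A * star A) u, u⟫_ℂ = ⟪(star A) u, (star A) u⟫_ℂ := by
    rw [ContinuousLinearMap.star_eq_adjoint, ContinuousLinearMap.adjoint_inner_right]; rfl
  have h2 : ⟪(star A * A) u, u⟫_ℂ = ⟪A u, A u⟫_ℂ := by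
    rw [ContinuousLinearMap.star_eq_adjoint, ← ContinuousLinearMap.adjoint_inner_left]; rfl
  rw [h1, h2, inner_self_eq_norm_sq_to_K, inner_self_eq_norm_sq_to_K] at h
  have h3 : ‖(star A) u‖ ^ 2 = ‖A u‖ ^ 2 := by exact_mod_cast h
  exact (sq_eq_sq₀ (norm_nonneg _) (norm_nonneg _)).1 h3



/-- Theorem 2.1, item 4 (bounded case): if `u` is a trace vector for a von
Neumann algebra `M`, cyclic both for `M` and for its commutant `M′`, and
`T ∈ M`, then the vector `T u` is cyclic and separating for `M` iff `T` is
injective and has dense range. -/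
theorem cyclic_and_separating_iff_injective_and_denseRange
    {H : Type*} [NormedAddCommGroup H] [InnerProductSpace ℂ H] [CompleteSpace H]
    (M : VonNeumannAlgebra H) (u : H)
    (htr : ∀ A B : H →L[ℂ] H, A ∈ M → B ∈ M →
      ⟪(A * B) u, u⟫_ℂ = ⟪(B * A) u, u⟫_ℂ)
    (hcyc : Dense {x : H | ∃ A ∈ M, A u = x})
    (hcyc' : Dense {x : H | ∃ A ∈ M.commutant, A u = x})
    (T : H →L[ℂ] H) (hT : T ∈ M) :
    (Dense {x : H | ∃ A ∈ M, A (T u) = x} ∧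
      (∀ A : H →L[ℂ] H, A ∈ M → A (T u) = 0 → A = 0)) ↔
    (Function.Injective T ∧ DenseRange T) := by
  -- `u` is separating for `M`
  have hsep : ∀ A : H →L[ℂ] H, A ∈ M → A u = 0 → A = 0 := by
    intro A hA h0
    have : (A : H → H) = (0 : H →L[ℂ] H) := by
      refine A.continuous.ext_on hcyc' (0 : H →L[ℂ] H).continuous ?_
      rintro x ⟨B, hB, rfl⟩
      have h := congrArg (fun C : H →L[ℂ] H => C u)
        (VonNeumannAlgebra.mem_commutant_iff.1 hB A hA)
      simpa [h0] using h
    exact DFunLike.coe_injective this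
  -- separating iff dense range
  have hA : (∀ A : H →L[ℂ] H, A ∈ M → A (T u) = 0 → A = 0) ↔ DenseRange T := by
    constructor
    · intro h
      have hP : (T.rangeᗮ).starProjection ∈ M := by
        rw [VonNeumannAlgebra.IsStarProjection.mem_iff isStarProjection_starProjection]
        intro y hy
        rw [Submodule.range_starProjection, ContinuousLinearMap.orthogonal_range]
        intro x hx
        have hc := congrArg (fun C : H →L[ℂ] H => C x)
          (VonNeumannAlgebra.mem_commutant_iff.1 hy (star T) (star_mem hT))
        have hx' : (star T) x = 0 := hx
        have : (star T) (y x) = 0 := by simpa [hx'] using hc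
        exact this
      have h0 := h _ hP (by
        rw [Submodule.starProjection_apply_eq_zero_iff]
        exact Submodule.le_orthogonal_orthogonal _ ⟨u, rfl⟩)
      rw [aux_denseRange_iff]
      refine (LinearMap.ker_eq_bot (f := ((star T : H →L[ℂ] H) : H →ₗ[ℂ] H))).1 ?_
      have h1 := ContinuousLinearMap.orthogonal_range T
      rw [ContinuousLinearMap.star_eq_adjoint]
      refine h1.symm.trans ?_
      rw [← Submodule.range_starProjection (T.rangeᗮ), h0]
      simp
    · intro hd A hA h0
      have h1 := hsep (A * T) (mul_mem hA hT) h0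
      have : (A : H → H) = (0 : H →L[ℂ] H) := by
        refine A.continuous.ext_on hd (0 : H →L[ℂ] H).continuous ?_
        rintro x ⟨z, rfl⟩
        exact congrArg (fun C : H →L[ℂ] H => C z) h1
      exact DFunLike.coe_injective this
  -- the antiunitary `A u ↦ A* u` is isometric
  have hnorm : ∀ A B : H →L[ℂ] H, A ∈ M → B ∈ M →
      dist ((star A) u) ((star T) ((star B) u)) = dist (A u) (B (T u)) := by
    intro A B hA hB
    have h := aux_norm M u htr (A - B * T) (sub_mem hA (mul_mem hB hT))
    rw [dist_eq_norm, dist_eq_norm]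
    simpa using h
  have hB : Dense {x : H | ∃ A ∈ M, A (T u) = x} ↔ Function.Injective T := by
    have h1 := aux_denseRange_iff (star T)
    rw [star_star] at h1
    rw [← h1]
    constructor
    · intro hd
      rw [DenseRange, ← dense_closure]
      refine hcyc.mono ?_
      rintro x ⟨A, hA, rfl⟩
      rw [Metric.mem_closure_iff]
      intro ε hε
      obtain ⟨_, ⟨B, hB, rfl⟩, hlt⟩ := Metric.mem_closure_iff.1 (hd ((star A) u)) ε hε
      refine ⟨_, ⟨(star B) u, rfl⟩, ?_⟩
      have := hnorm (star A) B (star_mem hA) hB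
      rw [star_star] at this
      rwa [this]
    · intro hd
      have hd2 : Dense ((star T : H →L[ℂ] H) '' {x : H | ∃ A ∈ M, A u = x}) :=
        hd.dense_image (star T).continuous hcyc
      rw [← dense_closure]
      refine hcyc.mono ?_
      rintro x ⟨A, hA, rfl⟩
      rw [Metric.mem_closure_iff]
      intro ε hε
      obtain ⟨_, ⟨_, ⟨B, hB, rfl⟩, rfl⟩, hlt⟩ :=
        Metric.mem_closure_iff.1 (hd2 ((star A) u)) ε hε
      refine ⟨_, ⟨star B, star_mem hB, rfl⟩, ?_⟩
      have := hnorm A (star B) hA (star_mem hB)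
      rw [star_star] at this
      rwa [← this]
  rw [hA, hB]
end
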